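/- Let A be a weakly acyclic NFA over a finite alphabet Σ. Then the language accepted by A is a finite union of languages of the form Λ₁*·a₁·Λ₂*·a₂ ⋯ Λₙ*·aₙ·Γ* (n ≥ 0), where Λ₁, …, Λₙ, Γ ⊆ Σ and aᵢ ∈ Σ \ Λᵢ for each i. -/

import Mathlib

/-- A DFA is *weakly acyclic* if whenever a nonempty word `w` loops on a state `q`,
every letter occurring in `w` self-loops on `q`. -/
def DFA.WeaklyAcyclic {α : Type*} {σ : Type*} (A : DFA α σ) : Prop :=
  ∀ (q : σ) (w : List α), w ≠ [] → A.evalFrom q w = q → ∀ a ∈ w, A.step q a = q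

/-- A language is weakly acyclic if it is accepted by some weakly acyclic DFA
with finitely many states. -/
def Language.IsWeaklyAcyclic {α : Type*} (L : Language α) : Prop :=
  ∃ (σ : Type) (_ : Fintype σ) (A : DFA α σ), A.WeaklyAcyclic ∧ A.accepts = L

/-- The residual of the language `L` with respect to the word `u`. -/
def Language.residual {α : Type*} (L : Language α) (u : List α) : Language α :=
  {v | u ++ v ∈ L}

/-- An NFA is *weakly acyclic* if whenever `q ∈ δ(q, w)` for a nonempty word `w`,
every letter occurring in `w` satisfies `δ(q, a) = {q}`. -/
def NFA.WeaklyAcyclic {α : Type*} {σ : Type*} (M : NFA α σ) : Prop :=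
  ∀ (q : σ) (w : List α), w ≠ [] → q ∈ M.evalFrom {q} w → ∀ a ∈ w, M.step q a = {q}

/-- The language `Λ₁*·a₁ ⋯ Λₙ*·aₙ·Γ*` described by the list `[(Λ₁,a₁),…,(Λₙ,aₙ)]`
and the final set `Γ`. -/
def pathLang {α : Type*} : List (Set α × α) → Set α → Language α
  | [], Γ => {w | ∀ b ∈ w, b ∈ Γ}
  | (Λ, a) :: rest, Γ =>
      {w | ∃ u v, (∀ b ∈ u, b ∈ Λ) ∧ v ∈ pathLang rest Γ ∧ w = u ++ a :: v}

namespace NFA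

/-- The set of states reachable from `q`. -/
def reachable {α σ : Type*} (M : NFA α σ) (q : σ) : Set σ :=
  {p | ∃ w, p ∈ M.evalFrom {q} w}

theorem mem_evalFrom_cons_of_mem_step {α σ : Type*} {M : NFA α σ} {p q r : σ} {a : α} {w : List α}
    (hp : p ∈ M.step q a) (hr : r ∈ M.evalFrom {p} w) : r ∈ M.evalFrom {q} (a :: w) := by
  rw [evalFrom_cons, stepSet_singleton, mem_evalFrom_iff_exists]
  exact ⟨p, hp, hr⟩

theorem WeaklyAcyclic.step_eq_of_mem {α σ : Type*} {M : NFA α σ} (h : M.WeaklyAcyclic) {q : σ}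
    {a : α} (hq : q ∈ M.step q a) : M.step q a = {q} :=
  h q [a] (by simp) (by simpa using hq) a (by simp)

theorem WeaklyAcyclic.reachable_ssubset {α σ : Type*} {M : NFA α σ} (h : M.WeaklyAcyclic)
    {p q : σ} {a : α} (hp : p ∈ M.step q a) (hpq : p ≠ q) : M.reachable p ⊂ M.reachable q := by
  refine ⟨fun r ⟨w, hw⟩ => ⟨a :: w, mem_evalFrom_cons_of_mem_step hp hw⟩, fun hsub => ?_⟩
  obtain ⟨w, hw⟩ := hsub (show q ∈ M.reachable q from ⟨[], rfl⟩)
  have hstep := h q (a :: w) (by simp) (mem_evalFrom_cons_of_mem_step hp hw) a (by simp)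
  rw [hstep] at hp
  exact hpq hp

/-- The letters that loop on `q` and lead nowhere else. -/
def loopLetters {α σ : Type*} (M : NFA α σ) (q : σ) : Set α :=
  {a | M.step q a = {q}}

theorem cons_mem_acceptsFrom_singleton {α σ : Type*} {M : NFA α σ} {q : σ} {a : α} {w : List α} :
    a :: w ∈ M.acceptsFrom {q} ↔ ∃ p ∈ M.step q a, w ∈ M.acceptsFrom {p} := by
  rw [cons_mem_acceptsFrom, stepSet_singleton, mem_acceptsFrom]
  simp only [mem_acceptsFrom, mem_evalFrom_iff_exists (S := M.step q a)]
  tauto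

/-- An accepted word either stays in `q`, or leaves `q` after a word of looping letters. -/
theorem mem_acceptsFrom_singleton_iff {α σ : Type*} {M : NFA α σ} {q : σ} {w : List α} :
    w ∈ M.acceptsFrom {q} ↔
      (q ∈ M.accept ∧ ∀ b ∈ w, b ∈ M.loopLetters q) ∨
      ∃ a, a ∉ M.loopLetters q ∧ ∃ p ∈ M.step q a, ∃ u v,
        (∀ b ∈ u, b ∈ M.loopLetters q) ∧ v ∈ M.acceptsFrom {p} ∧ w = u ++ a :: v := by
  induction w with
  | nil => simp
  | cons c w ih =>
    rw [cons_mem_acceptsFrom_singleton]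
    by_cases hc : c ∈ M.loopLetters q
    · have hstep : M.step q c = {q} := hc
      simp only [hstep, Set.mem_singleton_iff, exists_eq_left, ih, List.forall_mem_cons, hc,
        true_and]
      refine or_congr_right ⟨?_, ?_⟩
      · rintro ⟨a, ha, p, hp, u, v, hu, hv, rfl⟩
        exact ⟨a, ha, p, hp, c :: u, v, List.forall_mem_cons.2 ⟨hc, hu⟩, hv, rfl⟩
      · rintro ⟨a, ha, p, hp, _ | ⟨d, u⟩, v, hu, hv, hw⟩
        · obtain ⟨rfl, -⟩ := List.cons.inj hw
          exact absurd hc ha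
        · obtain ⟨-, rfl⟩ := List.cons.inj hw
          exact ⟨a, ha, p, hp, u, v, (List.forall_mem_cons.1 hu).2, hv, rfl⟩
    · constructor
      · rintro ⟨p, hp, hw⟩
        exact Or.inr ⟨c, hc, p, hp, [], w, by simp, hw, rfl⟩
      · rintro (⟨-, hw⟩ | ⟨a, ha, p, hp, _ | ⟨d, u⟩, v, hu, hv, hw⟩)
        · exact absurd (hw c (by simp)) hc
        · obtain ⟨rfl, rfl⟩ := List.cons.inj hw
          exact ⟨p, hp, hv⟩
        · obtain ⟨rfl, -⟩ := List.cons.inj hw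
          exact absurd (hu c (by simp)) hc

theorem WeaklyAcyclic.exists_finite_pathLang {α σ : Type*} [Finite α] [Finite σ] {M : NFA α σ}
    (h : M.WeaklyAcyclic) (q : σ) :
    ∃ S : Set (List (Set α × α) × Set α), S.Finite ∧ (∀ i ∈ S, ∀ p ∈ i.1, p.2 ∉ p.1) ∧
      ∀ w, w ∈ M.acceptsFrom {q} ↔ ∃ i ∈ S, w ∈ pathLang i.1 i.2 := by
  have hwf : WellFounded fun p q => M.reachable p ⊂ M.reachable q :=
    InvImage.wf M.reachable wellFounded_lt
  induction q using hwf.induction with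
  | _ q ih =>
    choose! S hfin hgood hmem using ih
    have hlt {a p} (ha : a ∉ M.loopLetters q) (hp : p ∈ M.step q a) :
        M.reachable p ⊂ M.reachable q :=
      h.reachable_ssubset hp fun hpq => ha (h.step_eq_of_mem (hpq ▸ hp))
    let stay : Set (List (Set α × α) × Set α) := {i | q ∈ M.accept ∧ i = ([], M.loopLetters q)}
    let leave (x : {x : α × σ // x.1 ∉ M.loopLetters q ∧ x.2 ∈ M.step q x.1}) :
        Set (List (Set α × α) × Set α) :=
      (fun i => ((M.loopLetters q, x.1.1) :: i.1, i.2)) '' S x.1.2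
    refine ⟨stay ∪ ⋃ x, leave x, ?_, ?_, fun w => ?_⟩
    · refine ((Set.finite_singleton _).subset fun i hi => hi.2).union (Set.finite_iUnion ?_)
      exact fun x => (hfin _ (hlt x.2.1 x.2.2)).image _
    · rintro i (⟨-, rfl⟩ | hi)
      · simp
      · obtain ⟨⟨⟨a, p⟩, ha, hp⟩, j, hj, rfl⟩ := Set.mem_iUnion.1 hi
        exact List.forall_mem_cons.2 ⟨ha, hgood p (hlt ha hp) j hj⟩
    · rw [mem_acceptsFrom_singleton_iff]
      constructor
      · rintro (⟨hq, hw⟩ | ⟨a, ha, p, hp, u, v, hu, hv, rfl⟩)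
        · exact ⟨_, Or.inl ⟨hq, rfl⟩, hw⟩
        · obtain ⟨i, hi, hvi⟩ := (hmem p (hlt ha hp) v).1 hv
          exact ⟨_, Or.inr (Set.mem_iUnion.2 ⟨⟨(a, p), ha, hp⟩, i, hi, rfl⟩), u, v, hu, hvi, rfl⟩
      · rintro ⟨i, ⟨hq, rfl⟩ | hi, hw⟩
        · exact Or.inl ⟨hq, hw⟩
        · obtain ⟨⟨⟨a, p⟩, ha, hp⟩, j, hj, rfl⟩ := Set.mem_iUnion.1 hi
          obtain ⟨u, v, hu, hv, rfl⟩ := hw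
          exact Or.inr ⟨a, ha, p, hp, u, v, hu, (hmem p (hlt ha hp) v).2 ⟨j, hj, hv⟩, rfl⟩

end NFA

/-- The language of a weakly acyclic NFA is a finite union of languages of the form
`Λ₁*·a₁ ⋯ Λₙ*·aₙ·Γ*` with `aᵢ ∉ Λᵢ`. -/
theorem weaklyAcyclic_nfa_lang_union {α σ : Type} [Fintype α] [Fintype σ]
    (M : NFA α σ) (q₀ : σ) (hstart : M.start = {q₀}) (h : M.WeaklyAcyclic) :
    ∃ (n : ℕ) (items : Fin n → List (Set α × α) × Set α),
      (∀ i : Fin n, ∀ p ∈ (items i).1, p.2 ∉ p.1) ∧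
      M.accepts = ⨆ i : Fin n, pathLang (items i).1 (items i).2 := by
  obtain ⟨S, hfin, hgood, hmem⟩ := h.exists_finite_pathLang q₀
  have := hfin.to_subtype
  obtain ⟨n, ⟨e⟩⟩ := Finite.exists_equiv_fin S
  refine ⟨n, fun i => e.symm i, fun i => hgood _ (e.symm i).2, ?_⟩
  ext w
  rw [NFA.accepts_eq_acceptsFrom_start, hstart, hmem, Language.mem_iSup]
  constructor
  · rintro ⟨i, hi, hw⟩
    exact ⟨e ⟨i, hi⟩, by simpa using hw⟩
  · rintro ⟨i, hw⟩
    exact ⟨_, (e.symm i).2, hw⟩
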